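/- Assume k = ℂ and Q, q are generic, and let n ≥ 2d. Then the category of ℂ-linear functors from 𝒞^B_d to finite-dimensional ℂ-vector spaces (the category 𝒫^d_{Q,q} of degree d two-parameter quantum polynomial functors) is equivalent to the category of finite-dimensional modules over the Schur algebra S^B_{Q,q}(n; d). -/

import Mathlib

noncomputable section
namespace QSP

open CategoryTheory

variable {k : Type*} [Field k]

def val (n : ℕ) (j : Fin n) : ℤ := 2 * (j : ℤ) - ((n : ℤ) - 1)

def KQmat (Q : k) (n : ℕ) : Matrix (Fin n) (Fin n) k := fun c b =>
  if val n b = 0 then (if c = b then Q⁻¹ else 0)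
  else (if c = Fin.rev b then 1 else 0) + (if val n b < 0 ∧ c = b then Q⁻¹ - Q else 0)

def Rmat (q : k) (n : ℕ) : Matrix (Fin n × Fin n) (Fin n × Fin n) k := fun c b =>
  if b.1 = b.2 then (if c = b then q⁻¹ else 0)
  else if b.1 < b.2 then (if c = (b.2, b.1) then 1 else 0)
  else (if c = (b.2, b.1) then 1 else 0) + (if c = b then q⁻¹ - q else 0)

def TB (Q q : k) (n d : ℕ) (i : ℕ) : Module.End k ((Fin d → Fin n) → k) :=
  if _h0 : i = 0 then
    if hd : 0 < d then
      Matrix.toLin' (fun c b =>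
        if ∀ j, j ≠ (⟨0, hd⟩ : Fin d) → c j = b j then
          KQmat Q n (c ⟨0, hd⟩) (b ⟨0, hd⟩) else 0)
    else 0
  else if hi : i < d then
    Matrix.toLin' (fun c b =>
      if ∀ j, j ≠ (⟨i - 1, Nat.lt_of_le_of_lt (Nat.pred_le i) hi⟩ : Fin d) →
          j ≠ (⟨i, hi⟩ : Fin d) → c j = b j then
        Rmat q n (c ⟨i - 1, Nat.lt_of_le_of_lt (Nat.pred_le i) hi⟩, c ⟨i, hi⟩)
          (b ⟨i - 1, Nat.lt_of_le_of_lt (Nat.pred_le i) hi⟩, b ⟨i, hi⟩) else 0)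
  else 0

/-- The type B Schur algebra `S^B_{Q,q}(n; d)`. -/
def schurB (Q q : k) (n d : ℕ) : Subalgebra k (Module.End k ((Fin d → Fin n) → k)) :=
  Subalgebra.centralizer k (TB Q q n d '' Set.Iio d)

/-- Objects of the quantum divided power category `𝒞^B_d`: the spaces `V_m` for `m ≥ 1`. -/
structure CBObj (k : Type*) [Field k] (Q q : k) (d : ℕ) : Type where
  m : ℕ
  hm : 0 < m

/-- The space of `ℋ^B_{Q,q}(d)`-intertwiners `V_m^{⊗d} → V_{m'}^{⊗d}`, i.e. the
morphism space `Hom_{𝒞^B_d}(V_m, V_{m'})`. -/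
def interSub (Q q : k) (d m m' : ℕ) :
    Submodule k (((Fin d → Fin m) → k) →ₗ[k] ((Fin d → Fin m') → k)) where
  carrier := {f | ∀ i < d, f ∘ₗ TB Q q m d i = TB Q q m' d i ∘ₗ f}
  add_mem' := by
    intro f g hf hg i hi
    rw [LinearMap.add_comp, LinearMap.comp_add, hf i hi, hg i hi]
  zero_mem' := by
    intro i hi
    rw [LinearMap.zero_comp, LinearMap.comp_zero]
  smul_mem' := by
    intro c f hf i hi
    rw [LinearMap.smul_comp, LinearMap.comp_smul, hf i hi]

/-- The quantum divided power category `𝒞^B_d`. -/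
instance instCBCategory {Q q : k} {d : ℕ} : Category (CBObj k Q q d) where
  Hom X Y := interSub Q q d X.m Y.m
  id X := ⟨LinearMap.id, by intro i hi; rw [LinearMap.id_comp, LinearMap.comp_id]⟩
  comp f g := ⟨g.1 ∘ₗ f.1, by
    intro i hi
    rw [LinearMap.comp_assoc, f.2 i hi, ← LinearMap.comp_assoc, g.2 i hi,
      LinearMap.comp_assoc]⟩
  id_comp f := by apply Subtype.ext; exact LinearMap.comp_id _
  comp_id f := by apply Subtype.ext; exact LinearMap.id_comp _
  assoc f g h := by apply Subtype.ext; exact (LinearMap.comp_assoc _ _ _).symm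

/-- `𝒞^B_d` is a preadditive category. -/
instance instCBPreadditive {Q q : k} {d : ℕ} : Preadditive (CBObj k Q q d) where
  homGroup X Y := inferInstanceAs (AddCommGroup (interSub Q q d X.m Y.m))
  add_comp X Y Z f f' g := by
    apply Subtype.ext
    show g.1 ∘ₗ (f.1 + f'.1) = g.1 ∘ₗ f.1 + g.1 ∘ₗ f'.1
    rw [LinearMap.comp_add]
  comp_add X Y Z f g g' := by
    apply Subtype.ext
    show (g.1 + g'.1) ∘ₗ f.1 = g.1 ∘ₗ f.1 + g'.1 ∘ₗ f.1
    rw [LinearMap.add_comp]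

/-- `𝒞^B_d` is a `k`-linear category. -/
instance instCBLinear {Q q : k} {d : ℕ} : CategoryTheory.Linear k (CBObj k Q q d) where
  homModule X Y := inferInstanceAs (Module k (interSub Q q d X.m Y.m))
  smul_comp X Y Z r f g := by
    apply Subtype.ext
    show g.1 ∘ₗ (r • f.1) = r • (g.1 ∘ₗ f.1)
    rw [LinearMap.comp_smul]
  comp_smul X Y Z f r g := by
    apply Subtype.ext
    show (r • g.1) ∘ₗ f.1 = r • (g.1 ∘ₗ f.1)
    rw [LinearMap.smul_comp]

/-- The category `𝒫^d_{Q,q}` of degree `d` two-parameter quantum polynomial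
functors: `k`-linear functors from `𝒞^B_d` to finite dimensional `k`-vector
spaces. -/
def PolFun.{u} (k : Type u) [Field k] (Q q : k) (d : ℕ) :=
  ObjectProperty.FullSubcategory (fun F : CBObj k Q q d ⥤ FGModuleCat.{u} k =>
    ∃ h : F.Additive, letI : F.Additive := h; F.Linear k)

instance (Q q : k) (d : ℕ) : Category (PolFun k Q q d) :=
  ObjectProperty.FullSubcategory.category _


/-! ### The operators in function form -/

section Op
variable {X Y : Type*} [DecidableEq X] [DecidableEq Y]

def op (p : ℂ) (s : X → X) (D : X → Prop) [DecidablePred D] : (X → ℂ) →ₗ[ℂ] (X → ℂ) where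
  toFun h x := if s x = x then p⁻¹ * h x else h (s x) + if D x then (p⁻¹ - p) * h x else 0
  map_add' h h' := by
    ext x; simp only [Pi.add_apply]; split_ifs <;> ring
  map_smul' c h := by
    ext x; simp only [Pi.smul_apply, smul_eq_mul, RingHom.id_apply]; split_ifs <;> ring

lemma op_apply (p : ℂ) (s : X → X) (D : X → Prop) [DecidablePred D] (h : X → ℂ) (x : X) :
    op p s D h x =
      if s x = x then p⁻¹ * h x else h (s x) + if D x then (p⁻¹ - p) * h x else 0 := rfl

/-- weighted pullback -/
def pull (c : Y → ℂ) (π : Y → X) : (X → ℂ) →ₗ[ℂ] (Y → ℂ) where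
  toFun h y := c y * h (π y)
  map_add' h h' := by
    ext x; simp only [Pi.add_apply]; ring
  map_smul' c h := by
    ext x; simp only [Pi.smul_apply, smul_eq_mul, RingHom.id_apply]; ring

/-- its transpose, the weighted push-forward -/
def push [Fintype Y] (c : Y → ℂ) (π : Y → X) : (Y → ℂ) →ₗ[ℂ] (X → ℂ) where
  toFun h x := ∑ y, if π y = x then c y * h y else 0
  map_add' h h' := by
    ext x; simp only [Pi.add_apply, ← Finset.sum_add_distrib]
    refine Finset.sum_congr rfl fun y _ => ?_
    split_ifs <;> ring
  map_smul' c h := by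
    ext x; simp only [Pi.smul_apply, smul_eq_mul, RingHom.id_apply, Finset.mul_sum]
    refine Finset.sum_congr rfl fun y _ => ?_
    split_ifs <;> ring

lemma pull_apply (c : Y → ℂ) (π : Y → X) (h : X → ℂ) (y : Y) :
    pull c π h y = c y * h (π y) := rfl

lemma push_apply [Fintype Y] (c : Y → ℂ) (π : Y → X) (h : Y → ℂ) (x : X) :
    push c π h x = ∑ y, if π y = x then c y * h y else 0 := rfl

lemma pull_op (p : ℂ) (s : X → X) (D : X → Prop) [DecidablePred D]
    (s' : Y → Y) (D' : Y → Prop) [DecidablePred D'] (c : Y → ℂ) (π : Y → X)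
    (hs : ∀ y, π (s' y) = s (π y))
    (h1 : ∀ y, s (π y) ≠ π y → c (s' y) = c y ∧ (D' y ↔ D (π y)))
    (h2 : ∀ y, s' y ≠ y → s (π y) = π y → c (s' y) = if D' y then p * c y else p⁻¹ * c y) :
    pull c π ∘ₗ op p s D = op p s' D' ∘ₗ pull c π := by
  apply LinearMap.ext
  intro h
  ext y
  simp only [LinearMap.comp_apply, op_apply, pull_apply]
  by_cases e1 : s' y = y
  · have e2 : s (π y) = π y := by rw [← hs, e1]
    rw [if_pos e1, if_pos e2]; ring
  · rw [if_neg e1, hs]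
    by_cases e2 : s (π y) = π y
    · rw [if_pos e2, h2 y e1 e2, e2]
      split_ifs <;> ring
    · rw [if_neg e2, (h1 y e2).1]
      have := (h1 y e2).2
      by_cases hD : D' y
      · rw [if_pos hD, if_pos (this.1 hD)]; ring
      · rw [if_neg hD, if_neg (fun h => hD (this.2 h))]; ring

lemma op_symm [Fintype X] (p : ℂ) (s : X → X) (D : X → Prop) [DecidablePred D]
    (hs : ∀ x, s (s x) = x) (f g : X → ℂ) :
    ∑ x, op p s D f x * g x = ∑ x, f x * op p s D g x := by
  have e : ∑ x, (if s x = x then 0 else f (s x) * g x) =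
      ∑ x, (if s x = x then 0 else f x * g (s x)) := by
    refine Fintype.sum_equiv ⟨s, s, hs, hs⟩ _ _ fun x => ?_
    simp only [Equiv.coe_fn_mk, hs, eq_comm]
  have e1 : ∀ x, op p s D f x * g x = (if s x = x then 0 else f (s x) * g x) +
      (if s x = x then p⁻¹ * f x * g x else if D x then (p⁻¹ - p) * f x * g x else 0) := by
    intro x; rw [op_apply]; split_ifs <;> ring
  have e2 : ∀ x, f x * op p s D g x = (if s x = x then 0 else f x * g (s x)) +
      (if s x = x then p⁻¹ * f x * g x else if D x then (p⁻¹ - p) * f x * g x else 0) := by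
    intro x; rw [op_apply]; split_ifs <;> ring
  simp only [e1, e2, Finset.sum_add_distrib, e]

lemma push_pull_adj [Fintype X] [Fintype Y] (c : Y → ℂ) (π : Y → X) (f : Y → ℂ) (g : X → ℂ) :
    ∑ x, push c π f x * g x = ∑ y, f y * pull c π g y := by
  simp only [push_apply, pull_apply, Finset.sum_mul]
  rw [Finset.sum_comm]
  refine Finset.sum_congr rfl fun y _ => ?_
  simp only [ite_mul, zero_mul, Finset.sum_ite_eq, Finset.mem_univ, if_true]
  ring

lemma dot_ext [Fintype X] (f g : X → ℂ) (h : ∀ k : X → ℂ, ∑ x, f x * k x = ∑ x, g x * k x) :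
    f = g := by
  classical
  ext x
  simpa [Pi.single_apply] using h (Pi.single x 1)

lemma push_op [Fintype X] [Fintype Y] (p : ℂ) (s : X → X) (D : X → Prop) [DecidablePred D]
    (s' : Y → Y) (D' : Y → Prop) [DecidablePred D'] (c : Y → ℂ) (π : Y → X)
    (hs : ∀ x, s (s x) = x) (hs' : ∀ x, s' (s' x) = x)
    (h : pull c π ∘ₗ op p s D = op p s' D' ∘ₗ pull c π) :
    push c π ∘ₗ op p s' D' = op p s D ∘ₗ push c π := by
  apply LinearMap.ext
  intro f
  apply dot_ext
  intro g
  simp only [LinearMap.comp_apply]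
  rw [push_pull_adj, op_symm _ _ _ hs', op_symm _ _ _ hs, push_pull_adj]
  have := LinearMap.congr_fun h g
  simp only [LinearMap.comp_apply] at this
  rw [this]

end Op

def s0 {n d : ℕ} (hd : 0 < d) (x : Fin d → Fin n) : Fin d → Fin n :=
  Function.update x ⟨0, hd⟩ (Fin.rev (x ⟨0, hd⟩))

def si {n d : ℕ} (a b : Fin d) (x : Fin d → Fin n) : Fin d → Fin n :=
  x ∘ Equiv.swap a b

lemma s0_s0 {n d : ℕ} (hd : 0 < d) (x : Fin d → Fin n) : s0 hd (s0 hd x) = x := by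
  simp [s0]

lemma si_si {n d : ℕ} (a b : Fin d) (x : Fin d → Fin n) : si a b (si a b x) = x := by
  ext j; simp [si]

lemma s0_eq {n d : ℕ} (hd : 0 < d) (x : Fin d → Fin n) :
    s0 hd x = x ↔ Fin.rev (x ⟨0, hd⟩) = x ⟨0, hd⟩ := by
  simp [s0]

lemma si_eq {n d : ℕ} (a b : Fin d) (x : Fin d → Fin n) :
    si a b x = x ↔ x a = x b := by
  constructor
  · intro h; have := congr_fun h b; simpa [si] using this
  · intro h; ext j
    simp only [si, Function.comp, Equiv.swap_apply_def]
    split_ifs with h1 h2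
    · rw [h1, h]
    · rw [h2, h]
    · rfl

lemma val_zero_iff {n : ℕ} (a : Fin n) : val n a = 0 ↔ Fin.rev a = a := by
  rw [Fin.ext_iff, Fin.val_rev]; unfold val; omega

lemma val_neg_iff {n : ℕ} (a : Fin n) : val n a < 0 ↔ a < Fin.rev a := by
  rw [Fin.lt_def, Fin.val_rev]; unfold val; omega

lemma TB_zero (Q q : ℂ) (n d : ℕ) (hd : 0 < d) :
    TB Q q n d 0 = op Q (s0 hd) (fun x => x ⟨0, hd⟩ < Fin.rev (x ⟨0, hd⟩)) := by
  apply LinearMap.toMatrix'.injective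
  rw [TB, dif_pos rfl, dif_pos hd]
  refine (LinearMap.toMatrix'_toLin' _).trans ?_
  ext x b
  simp only [LinearMap.toMatrix'_apply, op_apply,
    KQmat, val_zero_iff, val_neg_iff, s0_eq, Pi.single_apply]
  by_cases hag : ∀ j, j ≠ (⟨0, hd⟩ : Fin d) → x j = b j
  · rw [if_pos hag]
    have hxb : x = b ↔ x ⟨0, hd⟩ = b ⟨0, hd⟩ := by
      constructor
      · rintro rfl; rfl
      · intro h; ext j
        by_cases hj : j = ⟨0, hd⟩
        · rw [hj, h]
        · rw [hag j hj]
    have hsb : s0 hd x = b ↔ x ⟨0, hd⟩ = Fin.rev (b ⟨0, hd⟩) := by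
      rw [s0, Function.update_eq_iff]
      constructor
      · rintro ⟨h, -⟩; rw [← h, Fin.rev_rev]
      · intro h; exact ⟨by rw [h, Fin.rev_rev], hag⟩
    simp only [hxb, hsb]
    clear hxb hsb hag
    generalize x ⟨0, hd⟩ = u
    generalize b ⟨0, hd⟩ = v
    by_cases huv : u = v
    · subst huv
      by_cases h : Fin.rev u = u
      · simp [h]
      · simp [h]
    · have : ¬ v = u := fun h => huv h.symm
      simp only [huv, and_false, if_false, mul_zero, ite_self, add_zero]
      by_cases hu : u = Fin.rev v
      · have h1 : ¬ Fin.rev v = v := by rw [← hu]; exact huv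
        have h2 : ¬ Fin.rev u = u := by rw [hu, Fin.rev_rev]; exact fun h => h1 h.symm
        rw [if_neg h1, if_neg h2]
      · simp [hu]
  · rw [if_neg hag]
    have h1 : ¬ x = b := by rintro rfl; exact hag fun _ _ => rfl
    have h2 : ¬ s0 hd x = b := by
      intro h; rw [s0, Function.update_eq_iff] at h; exact hag h.2
    simp [h1, h2]

lemma TB_succ (Q q : ℂ) (n d i : ℕ) (hi : i + 1 < d) :
    TB Q q n d (i + 1) = op q (si (n := n) ⟨i, by omega⟩ ⟨i + 1, hi⟩)
      (fun x => x ⟨i + 1, hi⟩ < x ⟨i, by omega⟩) := by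
  apply LinearMap.toMatrix'.injective
  rw [TB, dif_neg (Nat.succ_ne_zero i), dif_pos hi]
  refine (LinearMap.toMatrix'_toLin' _).trans ?_
  ext x b
  have hne : (⟨i, by omega⟩ : Fin d) ≠ ⟨i + 1, hi⟩ := by simp
  simp only [Nat.add_sub_cancel, LinearMap.toMatrix'_apply, op_apply,
    Rmat, si_eq, Pi.single_apply]
  generalize (⟨i, by omega⟩ : Fin d) = k at *
  generalize (⟨i + 1, hi⟩ : Fin d) = l at *
  by_cases hag : ∀ j, j ≠ k → j ≠ l → x j = b j
  · rw [if_pos hag]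
    have hxb : x = b ↔ x k = b k ∧ x l = b l := by
      constructor
      · rintro rfl; exact ⟨rfl, rfl⟩
      · rintro ⟨h, h'⟩; ext j
        by_cases hj : j = k
        · rw [hj, h]
        by_cases hj : j = l
        · rw [hj, h']
        · rw [hag j ‹_› hj]
    have hsb : si k l x = b ↔ x k = b l ∧ x l = b k := by
      constructor
      · rintro rfl; simp [si]
      · rintro ⟨h, h'⟩; ext j
        by_cases hj : j = k
        · simp [si, hj, h']
        by_cases hj : j = l
        · simp [si, hj, h]
        · simp only [si, Function.comp]
          rw [Equiv.swap_apply_of_ne_of_ne ‹_› hj, hag j ‹_› hj]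
    simp only [hxb, hsb, Prod.mk.injEq]
    clear hxb hsb hag
    generalize x k = u
    generalize x l = u'
    generalize b k = v
    generalize b l = v'
    by_cases huv : u = v ∧ u' = v'
    · obtain ⟨rfl, rfl⟩ := huv
      rcases lt_trichotomy u u' with h | h | h
      · simp [h, h.ne, h.not_gt]
      · simp [h]
      · simp [h, h.ne', h.not_gt]
    · simp only [huv, if_false, mul_zero, ite_self, add_zero]
      by_cases hu : u = v' ∧ u' = v
      · obtain ⟨rfl, rfl⟩ := hu
        have h1 : ¬ u' = u := fun h => huv ⟨h.symm, h⟩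
        have h2 : ¬ u = u' := fun h => h1 h.symm
        simp [h1, h2]
      · simp [hu]
  · rw [if_neg hag]
    have h1 : ¬ x = b := by rintro rfl; exact hag fun _ _ _ => rfl
    have h2 : ¬ si k l x = b := by
      rintro rfl
      apply hag
      intro j hj hj'
      simp only [si, Function.comp]
      rw [Equiv.swap_apply_of_ne_of_ne hj hj']
    simp [h1, h2]

lemma pull_push_mem (Q q : ℂ) (d m n : ℕ) (c : (Fin d → Fin n) → ℂ) (π : Fin n → Fin m)
    (hmono : Monotone π) (hrev : ∀ a, π (Fin.rev a) = Fin.rev (π a))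
    (h0 : ∀ (hd : 0 < d) y, Fin.rev (π (y ⟨0, hd⟩)) ≠ π (y ⟨0, hd⟩) → c (s0 hd y) = c y)
    (h0' : ∀ (hd : 0 < d) y, Fin.rev (y ⟨0, hd⟩) ≠ y ⟨0, hd⟩ →
      Fin.rev (π (y ⟨0, hd⟩)) = π (y ⟨0, hd⟩) →
      c (s0 hd y) = if y ⟨0, hd⟩ < Fin.rev (y ⟨0, hd⟩) then Q * c y else Q⁻¹ * c y)
    (h1 : ∀ (k l : Fin d) y, (k : ℕ) + 1 = l → π (y k) ≠ π (y l) → c (si k l y) = c y)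
    (h1' : ∀ (k l : Fin d) y, (k : ℕ) + 1 = l → y k ≠ y l → π (y k) = π (y l) →
      c (si k l y) = if y l < y k then q * c y else q⁻¹ * c y) :
    pull c (fun y : Fin d → Fin n => π ∘ y) ∈ interSub Q q d m n ∧
    push c (fun y : Fin d → Fin n => π ∘ y) ∈ interSub Q q d n m := by
  have key : ∀ i < d, pull c (fun y : Fin d → Fin n => π ∘ y) ∘ₗ TB Q q m d i =
      TB Q q n d i ∘ₗ pull c (fun y : Fin d → Fin n => π ∘ y) := by
    intro i hi
    rcases i with _ | i
    · rw [TB_zero _ _ _ _ hi, TB_zero _ _ _ _ hi]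
      apply pull_op
      · intro y
        simp only [s0, Function.comp_update, hrev, Function.comp]
      · intro y hy
        rw [ne_eq, s0_eq] at hy
        refine ⟨h0 hi y hy, ?_⟩
        simp only [Function.comp] at hy ⊢
        constructor
        · intro h
          have := hmono h.le
          rw [hrev] at this
          exact lt_of_le_of_ne this (Ne.symm hy)
        · intro h
          rw [← hrev] at h
          exact hmono.reflect_lt h
      · intro y hy hy'
        rw [s0_eq] at hy'
        rw [ne_eq, s0_eq] at hy
        exact h0' hi y hy hy'
    · rw [TB_succ _ _ _ _ _ hi, TB_succ _ _ _ _ _ hi]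
      apply pull_op
      · intro y; rfl
      · intro y hy
        rw [ne_eq, si_eq] at hy
        refine ⟨h1 _ _ y rfl hy, ?_⟩
        simp only [Function.comp] at hy ⊢
        constructor
        · intro h
          exact lt_of_le_of_ne (hmono h.le) (Ne.symm hy)
        · intro h
          exact hmono.reflect_lt h
      · intro y hy hy'
        rw [si_eq] at hy'
        rw [ne_eq, si_eq] at hy
        exact h1' _ _ y rfl hy hy'
  refine ⟨key, ?_⟩
  intro i hi
  have := key i hi
  rcases i with _ | i
  · rw [TB_zero _ _ _ _ hi, TB_zero _ _ _ _ hi] at *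
    exact push_op _ _ _ _ _ _ _ (s0_s0 hi) (s0_s0 hi) this
  · rw [TB_succ _ _ _ _ _ hi, TB_succ _ _ _ _ _ hi] at *
    exact push_op _ _ _ _ _ _ _ (si_si _ _) (si_si _ _) this

/-- relabelling along a strictly monotone symmetric map -/
lemma relabel_mem (Q q : ℂ) (d r m : ℕ) (ι : Fin r → Fin m) (hι : StrictMono ι)
    (hrev : ∀ a, ι (Fin.rev a) = Fin.rev (ι a)) :
    pull 1 (fun y : Fin d → Fin r => ι ∘ y) ∈ interSub Q q d m r ∧
    push 1 (fun y : Fin d → Fin r => ι ∘ y) ∈ interSub Q q d r m := by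
  apply pull_push_mem Q q d m r 1 ι hι.monotone hrev
  · intros; rfl
  · intro hd y h heq
    rw [← hrev] at heq
    exact absurd (hι.injective heq) h
  · intros; rfl
  · intro k l y _ h heq
    exact absurd (hι.injective heq) h

/-- multiplication by an invariant function -/
lemma diag_mem (Q q : ℂ) (d m : ℕ) (θ : (Fin d → Fin m) → ℂ)
    (h0 : ∀ (hd : 0 < d) y, θ (s0 hd y) = θ y)
    (h1 : ∀ (k l : Fin d) y, θ (si k l y) = θ y) :
    pull θ (fun y : Fin d → Fin m => id ∘ y) ∈ interSub Q q d m m := by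
  apply (pull_push_mem Q q d m m θ id monotone_id (fun _ => rfl) _ _ _ _).1
  · intro hd y _; exact h0 hd y
  · intro hd y h heq; exact absurd heq h
  · intro k l y _ _; exact h1 k l y
  · intro k l y _ h heq; exact absurd heq h

/-! ### collapsing the two middle indices -/

def mid (t : ℕ) (a : Fin (2 * t + 2)) : Fin (2 * t + 1) :=
  ⟨if (a : ℕ) ≤ t then a else a - 1, by split_ifs <;> omega⟩

def cnt {d m : ℕ} (z : Fin m) (x : Fin d → Fin m) (j : Fin d) : ℕ :=
  ∑ i, if i < j ∧ x i = z then 1 else 0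

lemma cnt_zero {d m : ℕ} (hd : 0 < d) (z : Fin m) (x : Fin d → Fin m) : cnt z x ⟨0, hd⟩ = 0 := by
  simp [cnt, Fin.lt_def]

lemma cnt_succ {d m : ℕ} (z : Fin m) (x : Fin d → Fin m) (k l : Fin d) (h : (k : ℕ) + 1 = l) :
    cnt z x l = cnt z x k + if x k = z then 1 else 0 := by
  have : (if x k = z then 1 else 0) = ∑ i, if i = k ∧ x i = z then 1 else 0 := by
    simp only [ite_and, Finset.sum_ite_eq', Finset.mem_univ, if_true]
  rw [cnt, cnt, this, ← Finset.sum_add_distrib]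
  refine Finset.sum_congr rfl fun i _ => ?_
  have e : i < l ↔ i < k ∨ i = k := by rw [Fin.lt_def, Fin.lt_def, Fin.ext_iff]; omega
  have e' : ¬ (i < k ∧ i = k) := by rw [Fin.lt_def, Fin.ext_iff]; omega
  by_cases h1 : i < k
  · have : ¬ i = k := h1.ne
    simp [e, h1, this]
  · simp [e, h1]

lemma cnt_si {d m : ℕ} (z : Fin m) (x : Fin d → Fin m) (k l j : Fin d) (h : (k : ℕ) + 1 = l)
    (hj : j ≠ l) : cnt z (si k l x) j = cnt z x j := by
  rw [cnt, cnt]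
  refine Fintype.sum_equiv (Equiv.swap k l) _ _ fun i => ?_
  have : Equiv.swap k l i < j ↔ i < j := by
    rw [Equiv.swap_apply_def]
    rw [ne_eq, Fin.ext_iff] at hj
    split_ifs with h1 h2
    · subst h1; rw [Fin.lt_def, Fin.lt_def]; omega
    · subst h2; rw [Fin.lt_def, Fin.lt_def]; omega
    · rfl
  exact if_congr (and_congr this.symm Iff.rfl) rfl rfl

def ctr (t : ℕ) : Fin (2 * t + 1) := ⟨t, by omega⟩
def lo (t : ℕ) : Fin (2 * t + 2) := ⟨t, by omega⟩

def wt (Q q : ℂ) {d : ℕ} (t : ℕ) (x : Fin d → Fin (2 * t + 1)) (j : Fin d)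
    (a : Fin (2 * t + 2)) : ℂ :=
  if a = lo t then Q⁻¹ * (q⁻¹) ^ cnt (ctr t) x j else 1

def coef (Q q : ℂ) {d : ℕ} (t : ℕ) (y : Fin d → Fin (2 * t + 2)) : ℂ :=
  ∏ j, wt Q q t (mid t ∘ y) j (y j)

lemma mid_mono (t : ℕ) : Monotone (mid t) := by
  intro a b h
  rw [Fin.le_def] at *
  simp only [mid]
  split_ifs <;> omega

lemma mid_rev (t : ℕ) (a : Fin (2 * t + 2)) : mid t (Fin.rev a) = Fin.rev (mid t a) := by
  rw [Fin.ext_iff]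
  simp only [mid, Fin.val_rev]
  split_ifs <;> omega

lemma mid_eq_mid (t : ℕ) (a b : Fin (2 * t + 2)) (h : mid t a = mid t b) (hab : a < b) :
    a = lo t ∧ b ≠ lo t ∧ mid t a = ctr t := by
  simp only [mid, lo, ctr, Fin.ext_iff, Fin.lt_def, ne_eq] at *
  split_ifs at * <;> omega

lemma mid_lo_of_rev (t : ℕ) (a : Fin (2 * t + 2)) (h : Fin.rev (mid t a) = mid t a) :
    (a < Fin.rev a ↔ a = lo t) ∧ (Fin.rev a = lo t ↔ ¬ a = lo t)
      ∧ mid t (Fin.rev a) = mid t a := by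
  refine ⟨?_, ?_, by rw [mid_rev, h]⟩ <;>
  · simp only [mid, lo, Fin.ext_iff, Fin.lt_def, Fin.val_rev] at *
    split_ifs at * <;> omega

lemma mid_lo_of_rev_ne (t : ℕ) (a : Fin (2 * t + 2)) (h : Fin.rev (mid t a) ≠ mid t a) :
    a ≠ lo t ∧ Fin.rev a ≠ lo t ∧ mid t a ≠ ctr t ∧ mid t (Fin.rev a) ≠ ctr t := by
  simp only [mid, lo, ctr, ne_eq, Fin.ext_iff, Fin.val_rev] at *
  split_ifs at * <;> omega

lemma mid_lo (t : ℕ) : mid t (lo t) = ctr t := by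
  simp [mid, lo, ctr]

lemma coef_s0 (Q q : ℂ) {d : ℕ} (t : ℕ) (hd : 0 < d) (y : Fin d → Fin (2 * t + 2))
    (h : ∀ j, cnt (ctr t) (mid t ∘ s0 hd y) j = cnt (ctr t) (mid t ∘ y) j) (z : ℂ)
    (hz : (if Fin.rev (y ⟨0, hd⟩) = lo t then Q⁻¹ else 1) = z *
      (if y ⟨0, hd⟩ = lo t then Q⁻¹ else 1)) :
    coef Q q t (s0 hd y) = z * coef Q q t y := by
  rw [coef, coef, ← Finset.mul_prod_erase _ _ (Finset.mem_univ (⟨0, hd⟩ : Fin d)),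
    ← Finset.mul_prod_erase _ (fun j => wt Q q t (mid t ∘ y) j (y j))
      (Finset.mem_univ (⟨0, hd⟩ : Fin d)), ← mul_assoc]
  congr 1
  · simp only [wt, cnt_zero, pow_zero, mul_one, ← hz]
    simp [s0]
  · refine Finset.prod_congr rfl fun j hj => ?_
    have hj : j ≠ ⟨0, hd⟩ := (Finset.mem_erase.1 hj).1
    simp only [wt, h]
    simp [s0, hj]

lemma coef_si (Q q : ℂ) {d : ℕ} (t : ℕ) (k l : Fin d) (hkl : (k : ℕ) + 1 = l)
    (y : Fin d → Fin (2 * t + 2)) (z : ℂ)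
    (hz : ∀ N : ℕ,
      (if y l = lo t then Q⁻¹ * (q⁻¹) ^ N else 1) *
      (if y k = lo t then Q⁻¹ * (q⁻¹) ^ (N + if mid t (y l) = ctr t then 1 else 0) else 1) = z *
      ((if y k = lo t then Q⁻¹ * (q⁻¹) ^ N else 1) *
      (if y l = lo t then Q⁻¹ * (q⁻¹) ^ (N + if mid t (y k) = ctr t then 1 else 0) else 1))) :
    coef Q q t (si k l y) = z * coef Q q t y := by
  have hne : k ≠ l := by rintro rfl; omega
  have hlk : l ∈ (Finset.univ : Finset (Fin d)).erase k := by simp [hne.symm]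
  rw [coef, coef, ← Finset.mul_prod_erase _ _ (Finset.mem_univ k),
    ← Finset.mul_prod_erase _ (fun j => wt Q q t (mid t ∘ y) j (y j)) (Finset.mem_univ k),
    ← Finset.mul_prod_erase _ _ hlk,
    ← Finset.mul_prod_erase _ (fun j => wt Q q t (mid t ∘ y) j (y j)) hlk,
    ← mul_assoc, ← mul_assoc, ← mul_assoc]
  have hsi : mid t ∘ si k l y = si k l (mid t ∘ y) := rfl
  congr 1
  · have := hz (cnt (ctr t) (mid t ∘ y) k)
    simp only [wt]
    rw [hsi, cnt_succ _ (si k l (mid t ∘ y)) k l hkl, cnt_si _ _ _ _ _ hkl hne,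
      cnt_succ _ (mid t ∘ y) k l hkl, mul_assoc z]
    simpa [si] using this
  · refine Finset.prod_congr rfl fun j hj => ?_
    simp only [Finset.mem_erase] at hj
    simp only [wt, hsi]
    rw [cnt_si _ _ _ _ _ hkl hj.1]
    simp [si, Equiv.swap_apply_of_ne_of_ne hj.2.1 hj.1]

lemma collapse_mem (Q q : ℂ) (hQ : Q ≠ 0) (hq : q ≠ 0) (d t : ℕ) :
    pull (coef Q q t) (fun y : Fin d → Fin (2 * t + 2) => mid t ∘ y) ∈
      interSub Q q d (2 * t + 1) (2 * t + 2) ∧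
    push (coef Q q t) (fun y : Fin d → Fin (2 * t + 2) => mid t ∘ y) ∈
      interSub Q q d (2 * t + 2) (2 * t + 1) := by
  apply pull_push_mem _ _ _ _ _ _ _ (mid_mono t) (mid_rev t)
  · intro hd y hy
    obtain ⟨e1, e2, e3, e4⟩ := mid_lo_of_rev_ne t _ hy
    rw [coef_s0 Q q t hd y _ 1 _, one_mul]
    · intro j
      rw [cnt, cnt]
      refine Finset.sum_congr rfl fun i _ => ?_
      by_cases hi : i = ⟨0, hd⟩
      · subst hi; simp [s0, e3, e4]
      · simp [s0, hi]
    · simp [e1, e2]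
  · intro hd y hy hy'
    obtain ⟨e1, e2, e3⟩ := mid_lo_of_rev t _ hy'
    rw [coef_s0 Q q t hd y _ (if y ⟨0, hd⟩ < Fin.rev (y ⟨0, hd⟩) then Q else Q⁻¹) _]
    · split_ifs <;> rfl
    · intro j
      rw [cnt, cnt]
      refine Finset.sum_congr rfl fun i _ => ?_
      by_cases hi : i = ⟨0, hd⟩
      · subst hi; simp [s0, e3]
      · simp [s0, hi]
    · simp only [e1, e2]
      split_ifs <;> simp [hQ]
  · intro k l y hkl hy
    rw [coef_si Q q t k l hkl y 1, one_mul]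
    intro N
    by_cases h1 : y k = lo t
    · have h2 : ¬ mid t (y l) = ctr t := by rw [← mid_lo, ← h1]; exact fun h => hy h.symm
      have h3 : ¬ y l = lo t := by intro h; apply h2; rw [h, mid_lo]
      simp [h1, h2, h3]
    · by_cases h3 : y l = lo t
      · have h2 : ¬ mid t (y k) = ctr t := by rw [← mid_lo, ← h3]; exact hy
        simp [h1, h2, h3]
      · simp [h1, h3]
  · intro k l y hkl hy hy'
    rw [coef_si Q q t k l hkl y (if y l < y k then q else q⁻¹)]
    · split_ifs <;> rfl
    intro N
    rcases lt_or_gt_of_ne hy with h | h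
    · obtain ⟨e1, e2, e3⟩ := mid_eq_mid t _ _ hy' h
      rw [if_neg h.not_gt]
      simp only [if_neg e2, if_pos e1, ← hy', e3, if_true, pow_succ]
      ring
    · obtain ⟨e1, e2, e3⟩ := mid_eq_mid t _ _ hy'.symm h
      rw [if_pos h]
      simp only [if_neg e2, if_pos e1, hy', e3, if_true, pow_succ]
      field_simp

/-- the norm of the collapse -/
lemma norm_ne_zero (Q q : ℂ) (hQ : Q ≠ 0) (hq : q ≠ 0)
    (hgen : ∀ a b : ℤ, (a, b) ≠ (0, 0) → Q ^ a * q ^ b ≠ 1) (d t : ℕ)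
    (x : Fin d → Fin (2 * t + 1)) :
    (∑ y : Fin d → Fin (2 * t + 2), if mid t ∘ y = x then coef Q q t y * coef Q q t y else 0)
      ≠ 0 := by
  have e : (∑ y : Fin d → Fin (2 * t + 2),
      if mid t ∘ y = x then coef Q q t y * coef Q q t y else 0) =
      ∏ j, ∑ a ∈ Finset.univ.filter (fun a => mid t a = x j),
        wt Q q t x j a * wt Q q t x j a := by
    rw [Finset.prod_univ_sum, ← Finset.sum_filter]
    apply Finset.sum_congr
    · ext y; simp [funext_iff]
    · intro y hy
      have hy : mid t ∘ y = x := by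
        ext j; simp at hy; simp [hy j]
      rw [coef, hy, Finset.prod_mul_distrib]
  rw [e, Finset.prod_ne_zero_iff]
  intro j _
  by_cases hj : x j = ctr t
  · have : Finset.univ.filter (fun a => mid t a = x j) =
        {lo t, (⟨t + 1, by omega⟩ : Fin (2 * t + 2))} := by
      ext a
      rw [hj]
      simp only [Finset.mem_filter, Finset.mem_univ, true_and, Finset.mem_insert,
        Finset.mem_singleton, mid, ctr, lo, Fin.ext_iff]
      split_ifs <;> omega
    rw [this, Finset.sum_pair (by simp [lo])]
    have h2 : (⟨t + 1, by omega⟩ : Fin (2 * t + 2)) ≠ lo t := by simp [lo]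
    simp only [wt, if_true, if_neg h2, mul_one]
    intro h0
    apply hgen (-4) (-4 * (cnt (ctr t) x j : ℤ)) (by simp)
    generalize cnt (ctr t) x j = N at *
    have e1 : Q ^ (-4 : ℤ) * q ^ (-4 * (N : ℤ)) =
        ((Q⁻¹ * q⁻¹ ^ N) * (Q⁻¹ * q⁻¹ ^ N)) ^ 2 := by
      rw [neg_mul, zpow_neg, zpow_neg]
      have : q ^ (4 * (N : ℤ)) = (q ^ N) ^ 4 := by
        rw [← pow_mul, mul_comm 4]; exact_mod_cast rfl
      rw [this, inv_pow]
      have : Q ^ (4 : ℤ) = Q ^ 4 := by exact_mod_cast rfl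
      rw [this, ← inv_pow, ← inv_pow]
      ring
    rw [e1, eq_neg_of_add_eq_zero_left h0]
    norm_num
  · have : ∃ a, Finset.univ.filter (fun a => mid t a = x j) = {a} ∧ a ≠ lo t := by
      have hx := (x j).2
      have hne : (x j : ℕ) ≠ t := fun h => hj (by rw [ctr, Fin.ext_iff]; exact h)
      refine ⟨⟨if (x j : ℕ) < t then x j else x j + 1, by split_ifs <;> omega⟩, ?_, ?_⟩
      · ext a
        simp only [Finset.mem_filter, Finset.mem_univ, true_and,
          Finset.mem_singleton, mid, Fin.ext_iff]
        split_ifs <;> omega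
      · simp only [lo, ne_eq, Fin.ext_iff]
        split_ifs <;> omega
    obtain ⟨a, ha, ha'⟩ := this
    rw [ha, Finset.sum_singleton, wt, if_neg ha']
    norm_num

/-! ### Factorisations of the identity -/

/-- endomorphisms of `V_m` factoring through sums of copies of `V_n` -/
def thru (Q q : ℂ) (d m n : ℕ) :
    Submodule ℂ (((Fin d → Fin m) → ℂ) →ₗ[ℂ] ((Fin d → Fin m) → ℂ)) :=
  Submodule.span ℂ {a | ∃ f ∈ interSub Q q d m n, ∃ g ∈ interSub Q q d n m, a = g ∘ₗ f}

lemma inter_comp {Q q : ℂ} {d m n r : ℕ} {f : ((Fin d → Fin m) → ℂ) →ₗ[ℂ] ((Fin d → Fin n) → ℂ)}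
    {g : ((Fin d → Fin n) → ℂ) →ₗ[ℂ] ((Fin d → Fin r) → ℂ)}
    (hf : f ∈ interSub Q q d m n) (hg : g ∈ interSub Q q d n r) :
    g ∘ₗ f ∈ interSub Q q d m r := by
  intro i hi
  rw [LinearMap.comp_assoc, hf i hi, ← LinearMap.comp_assoc, hg i hi, LinearMap.comp_assoc]

lemma thru_comp {Q q : ℂ} {d m n r : ℕ}
    {u : ((Fin d → Fin m) → ℂ) →ₗ[ℂ] ((Fin d → Fin r) → ℂ)}
    {v : ((Fin d → Fin r) → ℂ) →ₗ[ℂ] ((Fin d → Fin m) → ℂ)}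
    {a : ((Fin d → Fin r) → ℂ) →ₗ[ℂ] ((Fin d → Fin r) → ℂ)}
    (hu : u ∈ interSub Q q d m r) (hv : v ∈ interSub Q q d r m) (ha : a ∈ thru Q q d r n) :
    v ∘ₗ a ∘ₗ u ∈ thru Q q d m n := by
  induction ha using Submodule.span_induction with
  | mem a ha =>
    obtain ⟨f, hf, g, hg, rfl⟩ := ha
    exact Submodule.subset_span ⟨f ∘ₗ u, inter_comp hu hf, v ∘ₗ g, inter_comp hg hv, rfl⟩
  | zero => simp
  | add a b _ _ ha hb =>
    rw [LinearMap.add_comp, LinearMap.comp_add]; exact Submodule.add_mem _ ha hb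
  | smul c a _ ha =>
    rw [LinearMap.smul_comp, LinearMap.comp_smul]; exact Submodule.smul_mem _ _ ha

lemma thru_trans {Q q : ℂ} {d m n r : ℕ} {w : ((Fin d → Fin m) → ℂ) →ₗ[ℂ] ((Fin d → Fin m) → ℂ)}
    (hw : w ∈ thru Q q d m r) (h : LinearMap.id ∈ thru Q q d r n) :
    w ∈ thru Q q d m n := by
  induction hw using Submodule.span_induction with
  | mem a ha =>
    obtain ⟨f, hf, g, hg, rfl⟩ := ha
    exact thru_comp hf hg h
  | zero => simp
  | add a b _ _ ha hb => exact Submodule.add_mem _ ha hb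
  | smul c a _ ha => exact Submodule.smul_mem _ _ ha

lemma thru_relabel (Q q : ℂ) (d r n : ℕ) (ι : Fin r → Fin n) (hι : StrictMono ι)
    (hrev : ∀ a, ι (Fin.rev a) = Fin.rev (ι a)) : LinearMap.id ∈ thru Q q d r n := by
  obtain ⟨h1, h2⟩ := relabel_mem Q q d r n ι hι hrev
  refine Submodule.subset_span ⟨_, h2, _, h1, ?_⟩
  apply LinearMap.ext
  intro h
  ext x
  simp only [LinearMap.comp_apply, pull_apply, push_apply, LinearMap.id_apply, Pi.one_apply,
    one_mul]
  have : ∀ y : Fin d → Fin r, ι ∘ y = ι ∘ x ↔ y = x := fun y =>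
    hι.injective.comp_left.eq_iff
  simp [this]

lemma thru_collapse (Q q : ℂ) (hQ : Q ≠ 0) (hq : q ≠ 0)
    (hgen : ∀ a b : ℤ, (a, b) ≠ (0, 0) → Q ^ a * q ^ b ≠ 1) (d t : ℕ) :
    LinearMap.id ∈ thru Q q d (2 * t + 1) (2 * t + 2) := by
  obtain ⟨h1, h2⟩ := collapse_mem Q q hQ hq d t
  set N : (Fin d → Fin (2 * t + 1)) → ℂ := fun x =>
    ∑ y : Fin d → Fin (2 * t + 2), if mid t ∘ y = x then coef Q q t y * coef Q q t y else 0
    with hN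
  have hN0 : ∀ x, N x ≠ 0 := norm_ne_zero Q q hQ hq hgen d t
  have hD : push (coef Q q t) (fun y : Fin d → Fin (2 * t + 2) => mid t ∘ y) ∘ₗ
      pull (coef Q q t) (fun y : Fin d → Fin (2 * t + 2) => mid t ∘ y) = pull N id := by
    apply LinearMap.ext
    intro h
    ext x
    simp only [LinearMap.comp_apply, pull_apply, push_apply, id, hN, Finset.sum_mul]
    refine Finset.sum_congr rfl fun y _ => ?_
    split_ifs with hy
    · rw [hy, mul_assoc]
    · simp
  have hE1 : pull N⁻¹ id ∘ₗ pull N id = LinearMap.id := by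
    apply LinearMap.ext
    intro h
    ext x
    simp only [LinearMap.comp_apply, pull_apply, id, LinearMap.id_apply, Pi.inv_apply]
    field_simp [hN0 x]
  have hE2 : pull N id ∘ₗ pull N⁻¹ id = LinearMap.id := by
    apply LinearMap.ext
    intro h
    ext x
    simp only [LinearMap.comp_apply, pull_apply, id, LinearMap.id_apply, Pi.inv_apply]
    field_simp [hN0 x]
  have hDm : pull N id ∈ interSub Q q d (2 * t + 1) (2 * t + 1) := hD ▸ inter_comp h1 h2
  have hEm : pull N⁻¹ id ∈ interSub Q q d (2 * t + 1) (2 * t + 1) := by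
    intro i hi
    have := hDm i hi
    calc pull N⁻¹ id ∘ₗ TB Q q (2 * t + 1) d i
        = pull N⁻¹ id ∘ₗ (TB Q q (2 * t + 1) d i ∘ₗ pull N id) ∘ₗ pull N⁻¹ id := by
          rw [LinearMap.comp_assoc, hE2, LinearMap.comp_id]
      _ = (pull N⁻¹ id ∘ₗ pull N id) ∘ₗ TB Q q (2 * t + 1) d i ∘ₗ pull N⁻¹ id := by
          rw [← this]; simp only [LinearMap.comp_assoc]
      _ = _ := by rw [hE1, LinearMap.id_comp]
  refine Submodule.subset_span ⟨_, h1, _, inter_comp h2 hEm, ?_⟩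
  rw [LinearMap.comp_assoc, hD, hE1]

lemma thru_small (Q q : ℂ) (hQ : Q ≠ 0) (hq : q ≠ 0)
    (hgen : ∀ a b : ℤ, (a, b) ≠ (0, 0) → Q ^ a * q ^ b ≠ 1) (d r n : ℕ)
    (hr : r ≤ 2 * d) (hn : 2 * d ≤ n) :
    LinearMap.id ∈ thru Q q d r n := by
  have even : ∀ t, 2 * t ≤ n → LinearMap.id ∈ thru Q q d (2 * t) n := by
    intro t ht
    apply thru_relabel Q q d (2 * t) n
      (fun a => ⟨if (a : ℕ) < t then a else n - 2 * t + a, by split_ifs <;> omega⟩)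
    · intro a b hab
      rw [Fin.lt_def] at *
      simp only
      split_ifs <;> omega
    · intro a
      rw [Fin.ext_iff]
      simp only [Fin.val_rev]
      split_ifs <;> omega
  rcases Nat.even_or_odd' r with ⟨t, rfl | rfl⟩
  · exact even t (by omega)
  · rcases Nat.even_or_odd' n with ⟨s, rfl | rfl⟩
    · exact thru_trans (thru_collapse Q q hQ hq hgen d t) (even (t + 1) (by omega))
    · apply thru_relabel Q q d (2 * t + 1) (2 * s + 1) (fun a => ⟨s - t + a, by omega⟩)
      · intro a b hab
        rw [Fin.lt_def] at *
        simp only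
        omega
      · intro a
        rw [Fin.ext_iff]
        simp only [Fin.val_rev]
        omega

def supp {d m : ℕ} (x : Fin d → Fin m) : Finset (Fin m) :=
  Finset.univ.image x ∪ Finset.univ.image (fun j => Fin.rev (x j))

lemma mem_supp {d m : ℕ} (x : Fin d → Fin m) (a : Fin m) :
    a ∈ supp x ↔ ∃ j, x j = a ∨ x j = Fin.rev a := by
  simp only [supp, Finset.mem_union, Finset.mem_image, Finset.mem_univ, true_and, ← exists_or,
    Fin.rev_eq_iff]

lemma supp_s0 {d m : ℕ} (hd : 0 < d) (x : Fin d → Fin m) : supp (s0 hd x) = supp x := by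
  ext a
  rw [mem_supp, mem_supp]
  refine exists_congr fun j => ?_
  by_cases hj : j = ⟨0, hd⟩
  · subst hj
    simp only [s0, Function.update_self, Fin.rev_eq_iff, Fin.rev_rev]
    exact or_comm
  · simp [s0, hj]

lemma supp_si {d m : ℕ} (k l : Fin d) (x : Fin d → Fin m) : supp (si k l x) = supp x := by
  ext a
  rw [mem_supp, mem_supp]
  exact (Equiv.swap k l).exists_congr_left.trans (by simp [si])

lemma supp_rev {d m : ℕ} (x : Fin d → Fin m) (a : Fin m) (ha : a ∈ supp x) :
    Fin.rev a ∈ supp x := by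
  rw [mem_supp] at *
  simpa [or_comm] using ha

lemma supp_card {d m : ℕ} (x : Fin d → Fin m) : (supp x).card ≤ 2 * d := by
  have h1 : (Finset.univ.image x).card ≤ d := by simpa using Finset.card_image_le (s := Finset.univ) (f := x)
  have h2 : (Finset.univ.image (fun j => Fin.rev (x j))).card ≤ d := by
    simpa using Finset.card_image_le (s := Finset.univ) (f := fun j => Fin.rev (x j))
  have := Finset.card_union_le (Finset.univ.image x) (Finset.univ.image (fun j => Fin.rev (x j)))
  unfold supp
  omega

lemma thru_all (Q q : ℂ) (hQ : Q ≠ 0) (hq : q ≠ 0)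
    (hgen : ∀ a b : ℤ, (a, b) ≠ (0, 0) → Q ^ a * q ^ b ≠ 1) (d m n : ℕ)
    (hn : 2 * d ≤ n) :
    LinearMap.id ∈ thru Q q d m n := by
  let θ : Finset (Fin m) → (Fin d → Fin m) → ℂ := fun S x => if supp x = S then 1 else 0
  have hsum : (LinearMap.id : ((Fin d → Fin m) → ℂ) →ₗ[ℂ] ((Fin d → Fin m) → ℂ)) =
      ∑ S : Finset (Fin m), pull (θ S) (fun y : Fin d → Fin m => id ∘ y) := by
    apply LinearMap.ext
    intro h
    ext x
    simp [pull_apply, θ, LinearMap.sum_apply, Finset.sum_apply]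
  rw [hsum]
  refine Submodule.sum_mem _ fun S _ => ?_
  by_cases hS : ∃ x : Fin d → Fin m, supp x = S
  · obtain ⟨x0, hx0⟩ := hS
    have hm : pull (θ S) (fun y : Fin d → Fin m => id ∘ y) ∈ interSub Q q d m m := by
      apply diag_mem
      · intro hd y; simp only [θ, supp_s0]
      · intro k l y; simp only [θ, supp_si]
    have hst : ∀ a ∈ S, Fin.rev a ∈ S := hx0 ▸ supp_rev x0
    let ι := S.orderEmbOfFin rfl
    have hrange : Set.range ι = S := Finset.range_orderEmbOfFin S rfl
    have hrev : ∀ a, ι (Fin.rev a) = Fin.rev (ι a) := by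
      have hu : (fun a => Fin.rev (ι (Fin.rev a))) = ι := by
        apply Finset.orderEmbOfFin_unique rfl
        · intro a
          exact hst _ (Finset.orderEmbOfFin_mem S rfl _)
        · intro a b hab
          simp only [Fin.rev_lt_rev]
          exact ι.strictMono (Fin.rev_lt_rev.2 hab)
      intro a
      have := congr_fun hu a
      rw [← this, Fin.rev_rev]
    obtain ⟨h1, h2⟩ := relabel_mem Q q d S.card m ι ι.strictMono hrev
    have hid := thru_small Q q hQ hq hgen d S.card n (hx0 ▸ supp_card x0) hn
    have := thru_comp h1 (inter_comp h2 hm) hid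
    convert this using 1
    apply LinearMap.ext
    intro h
    ext x
    simp only [LinearMap.comp_apply, pull_apply, push_apply, LinearMap.id_apply, Pi.one_apply,
      one_mul, θ]
    split_ifs with hx
    · have : ∃ y : Fin d → Fin S.card, ι ∘ y = x := by
        have : ∀ j, ∃ b, ι b = x j := by
          intro j
          have : x j ∈ (S : Set (Fin m)) := by
            rw [Finset.mem_coe, ← hx, mem_supp]; exact ⟨j, Or.inl rfl⟩
          rwa [← hrange] at this
        choose y hy using this
        exact ⟨y, funext hy⟩
      obtain ⟨y, rfl⟩ := this
      have e : ∀ z : Fin d → Fin S.card, ι ∘ z = id ∘ ι ∘ y ↔ z = y := fun z =>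
        ι.injective.comp_left.eq_iff
      simp only [e]
      simp
    · simp
  · have : pull (θ S) (fun y : Fin d → Fin m => id ∘ y) = 0 := by
      apply LinearMap.ext
      intro h
      ext x
      have : ¬ supp x = S := fun h => hS ⟨x, h⟩
      simp [pull_apply, θ, this]
    rw [this]
    exact Submodule.zero_mem _

/-! ### Morita theory -/

section Morita

variable {C : Type} [Category.{0} C] [Preadditive C] [CategoryTheory.Linear ℂ C]

def PLin (C : Type) [Category.{0} C] [Preadditive C] [CategoryTheory.Linear ℂ C] :
    ObjectProperty (C ⥤ FGModuleCat.{0} ℂ) := fun F =>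
  ∃ h : F.Additive, letI : F.Additive := h; F.Linear ℂ

def lmap (F : C ⥤ FGModuleCat.{0} ℂ) {X Y : C} (f : X ⟶ Y) : F.obj X →ₗ[ℂ] F.obj Y :=
  (F.map f).hom.hom

lemma lmap_id (F : C ⥤ FGModuleCat.{0} ℂ) (X : C) : lmap F (𝟙 X) = LinearMap.id := by
  rw [lmap, F.map_id]; rfl

lemma lmap_comp (F : C ⥤ FGModuleCat.{0} ℂ) {X Y Z : C} (f : X ⟶ Y) (g : Y ⟶ Z) :
    lmap F (f ≫ g) = lmap F g ∘ₗ lmap F f := by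
  rw [lmap, F.map_comp]; rfl

lemma lmap_add {F : C ⥤ FGModuleCat.{0} ℂ} (hF : PLin C F) {X Y : C} (f g : X ⟶ Y) :
    lmap F (f + g) = lmap F f + lmap F g := by
  obtain ⟨h, _⟩ := hF
  rw [lmap, F.map_add]; rfl

lemma lmap_smul {F : C ⥤ FGModuleCat.{0} ℂ} (hF : PLin C F) {X Y : C} (c : ℂ) (f : X ⟶ Y) :
    lmap F (c • f) = c • lmap F f := by
  obtain ⟨h, h'⟩ := hF
  rw [lmap, h'.map_smul]; rfl

def lmapHom {F : C ⥤ FGModuleCat.{0} ℂ} (hF : PLin C F) (X Y : C) :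
    (X ⟶ Y) →ₗ[ℂ] (F.obj X →ₗ[ℂ] F.obj Y) where
  toFun f := lmap F f
  map_add' := lmap_add hF
  map_smul' := lmap_smul hF

lemma lmap_sum {F : C ⥤ FGModuleCat.{0} ℂ} (hF : PLin C F) {X Y : C} {N : ℕ}
    (f : Fin N → (X ⟶ Y)) : lmap F (∑ i, f i) = ∑ i, lmap F (f i) :=
  map_sum (lmapHom hF X Y) f Finset.univ

variable {Z : C} {S : Type} [Ring S] [Algebra ℂ S] (e : S ≃ₐ[ℂ] End Z)

/-- the value of `F` at `Z` as an `S`-module -/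
def Ev (_ : S ≃ₐ[ℂ] End Z) (F : (PLin C).FullSubcategory) : Type := F.obj.obj Z

instance (F : (PLin C).FullSubcategory) : AddCommGroup (Ev e F) :=
  inferInstanceAs (AddCommGroup (F.obj.obj Z))

instance (F : (PLin C).FullSubcategory) : Module ℂ (Ev e F) :=
  inferInstanceAs (Module ℂ (F.obj.obj Z))

instance (F : (PLin C).FullSubcategory) : Module.Finite ℂ (Ev e F) :=
  inferInstanceAs (Module.Finite ℂ (F.obj.obj Z))

def evHom (F : (PLin C).FullSubcategory) : S →+* Module.End ℂ (Ev e F) where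
  toFun s := lmap F.obj (e s : Z ⟶ Z)
  map_one' := by rw [map_one]; exact lmap_id _ _
  map_mul' s t := by rw [map_mul]; exact lmap_comp _ _ _
  map_zero' := by rw [map_zero]; exact (lmapHom F.property Z Z).map_zero
  map_add' s t := by rw [map_add]; exact lmap_add F.property _ _

instance (F : (PLin C).FullSubcategory) : Module S (Ev e F) :=
  Module.compHom _ (evHom e F)

lemma ev_smul (F : (PLin C).FullSubcategory) (s : S) (x : Ev e F) :
    s • x = lmap F.obj (e s : Z ⟶ Z) x := rfl

instance (F : (PLin C).FullSubcategory) : IsScalarTower ℂ S (Ev e F) where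
  smul_assoc c s x := by
    rw [ev_smul, ev_smul, map_smul]
    exact LinearMap.congr_fun (lmap_smul F.property c (e s : Z ⟶ Z)) x

instance (F : (PLin C).FullSubcategory) : Module.Finite S (Ev e F) :=
  Module.Finite.of_restrictScalars_finite ℂ S (Ev e F)

lemma nat_lmap {F G : C ⥤ FGModuleCat.{0} ℂ} (η : F ⟶ G) {X Y : C} (f : X ⟶ Y) (x : F.obj X) :
    (η.app Y).hom.hom (lmap F f x) = lmap G f ((η.app X).hom.hom x) := by
  have := η.naturality f
  exact LinearMap.congr_fun (congrArg (fun a => a.hom.hom) this) x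

def evFunctor : (PLin C).FullSubcategory ⥤ FGModuleCat.{0} S where
  obj F := FGModuleCat.of S (Ev e F)
  map {F G} η := FGModuleCat.ofHom
    { toFun := fun x : Ev e F => ((η.hom.app Z).hom.hom x : Ev e G)
      map_add' := fun x y => (η.hom.app Z).hom.hom.map_add x y
      map_smul' := fun s x => nat_lmap η.hom (e s : Z ⟶ Z) x }
  map_id F := rfl
  map_comp f g := rfl

def Gen (Z : C) : Prop := ∀ X : C, ∃ (N : ℕ) (f : Fin N → (X ⟶ Z)) (g : Fin N → (Z ⟶ X)),
  ∑ i, f i ≫ g i = 𝟙 X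

lemma ev_faithful (hZ : Gen Z) : (evFunctor e).Faithful where
  map_injective {F G} η η' h := by
    have hh : ∀ x, (η.hom.app Z).hom.hom x = (η'.hom.app Z).hom.hom x := by
      intro x
      exact congrArg (fun a : (evFunctor e).obj F ⟶ (evFunctor e).obj G =>
        (show Ev e F →ₗ[S] Ev e G from a.hom.hom) x) h
    apply ObjectProperty.hom_ext
    ext X x
    obtain ⟨N, f, g, hfg⟩ := hZ X
    have hx : x = ∑ i, lmap F.obj (g i) (lmap F.obj (f i) x) := by
      have := congrArg (fun a => lmap F.obj a x) hfg
      simp only [lmap_sum F.property, lmap_id, lmap_comp, LinearMap.sum_apply,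
        LinearMap.comp_apply, LinearMap.id_apply] at this
      exact this.symm
    rw [hx, map_sum, map_sum]
    refine Finset.sum_congr rfl fun i _ => ?_
    rw [nat_lmap η.hom (g i), nat_lmap η'.hom (g i), hh]

lemma ev_full (hZ : Gen Z) : (evFunctor e).Full where
  map_surjective {F G} φ := by
    choose N f g hfg using hZ
    let φ0 : Ev e F →ₗ[S] Ev e G := φ.hom.hom
    let φ' : F.obj.obj Z →ₗ[ℂ] G.obj.obj Z := φ0.restrictScalars ℂ
    have hφ : ∀ (a : Z ⟶ Z) (x : F.obj.obj Z), φ' (lmap F.obj a x) = lmap G.obj a (φ' x) := by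
      intro a x
      have h1 : φ0 (lmap F.obj (e (e.symm a) : Z ⟶ Z) x) =
          lmap G.obj (e (e.symm a) : Z ⟶ Z) (φ0 x) := φ0.map_smul (e.symm a) x
      rw [AlgEquiv.apply_symm_apply] at h1
      exact h1
    let η : ∀ X, F.obj.obj X →ₗ[ℂ] G.obj.obj X := fun X =>
      ∑ i, lmap G.obj (g X i) ∘ₗ φ' ∘ₗ lmap F.obj (f X i)
    have key : ∀ {X Y : C} (a : X ⟶ Y) (x : F.obj.obj X),
        η Y (lmap F.obj a x) = lmap G.obj a (η X x) := by
      intro X Y a x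
      have h1 : η Y (lmap F.obj a x) = ∑ j, ∑ i,
          lmap G.obj (g Y j) (φ' (lmap F.obj (g X i ≫ a ≫ f Y j) (lmap F.obj (f X i) x))) := by
        simp only [η, LinearMap.sum_apply, LinearMap.comp_apply]
        refine Finset.sum_congr rfl fun j _ => ?_
        rw [← map_sum, ← map_sum]
        have : a ≫ f Y j = ∑ i, f X i ≫ g X i ≫ a ≫ f Y j := by
          have := congrArg (fun b => b ≫ a ≫ f Y j) (hfg X)
          simp only [Preadditive.sum_comp, Category.id_comp, Category.assoc] at this
          exact this.symm
        have h2 := congrArg (fun b => lmap F.obj b x) this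
        simp only [lmap_sum F.property] at h2
        simp only [lmap_comp, LinearMap.sum_apply, LinearMap.comp_apply] at h2 ⊢
        rw [h2]
      have h2 : lmap G.obj a (η X x) = ∑ i, ∑ j,
          lmap G.obj (g Y j) (lmap G.obj (g X i ≫ a ≫ f Y j) (φ' (lmap F.obj (f X i) x))) := by
        simp only [η, LinearMap.sum_apply, LinearMap.comp_apply]
        rw [map_sum]
        refine Finset.sum_congr rfl fun i _ => ?_
        have : a = ∑ j, a ≫ f Y j ≫ g Y j := by
          have := congrArg (fun b => a ≫ b) (hfg Y)
          simp only [Preadditive.comp_sum, Category.comp_id] at this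
          exact this.symm
        have h2 := congrArg (fun b => lmap G.obj b
          (lmap G.obj (g X i) (φ' (lmap F.obj (f X i) x)))) this
        simp only [lmap_sum G.property] at h2
        simp only [lmap_comp, LinearMap.sum_apply, LinearMap.comp_apply] at h2 ⊢
        exact h2
      rw [h1, h2, Finset.sum_comm]
      simp only [hφ]
    have hηZ : ∀ x, η Z x = φ' x := by
      intro x
      simp only [η, LinearMap.sum_apply, LinearMap.comp_apply, ← hφ]
      rw [← map_sum]
      have := congrArg (fun b => lmap F.obj b x) (hfg Z)
      simp only [lmap_sum F.property, lmap_id] at this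
      simp only [lmap_comp, LinearMap.sum_apply, LinearMap.comp_apply, LinearMap.id_apply] at this
      rw [this]
    refine ⟨⟨{ app := fun X => FGModuleCat.ofHom (η X), naturality := ?_ }⟩, ?_⟩
    · intro X Y a
      apply FGModuleCat.hom_ext
      apply LinearMap.ext
      intro x
      exact key a x
    · apply FGModuleCat.hom_ext
      apply LinearMap.ext
      intro x
      exact hηZ x

variable (Z) in
/-- the coinduced functor -/
def coind (M : Type) [AddCommGroup M] [Module S M] [Module ℂ M] [IsScalarTower ℂ S M] (X : C) :
    Submodule ℂ ((X ⟶ Z) →ₗ[ℂ] M) where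
  carrier := {φ | ∀ (s : S) (u : X ⟶ Z), φ (u ≫ (e s : Z ⟶ Z)) = s • φ u}
  add_mem' {φ ψ} h h' s u := by
    rw [LinearMap.add_apply, LinearMap.add_apply, h, h', smul_add]
  zero_mem' s u := by simp
  smul_mem' c φ h s u := by
    rw [LinearMap.smul_apply, LinearMap.smul_apply, h, smul_algebra_smul_comm]

def coindMap (M : Type) [AddCommGroup M] [Module S M] [Module ℂ M] [IsScalarTower ℂ S M]
    {X Y : C} (a : X ⟶ Y) : coind Z e M X →ₗ[ℂ] coind Z e M Y where
  toFun φ := ⟨φ.1 ∘ₗ CategoryTheory.Linear.leftComp ℂ Z a, by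
    intro s u
    have := φ.2 s (a ≫ u)
    simpa using this⟩
  map_add' φ ψ := rfl
  map_smul' c φ := rfl

lemma coindMap_apply (M : Type) [AddCommGroup M] [Module S M] [Module ℂ M] [IsScalarTower ℂ S M]
    {X Y : C} (a : X ⟶ Y) (φ : coind Z e M X) (u : Y ⟶ Z) :
    (coindMap e M a φ).1 u = φ.1 (a ≫ u) := rfl

def coindFunctor (hfin : ∀ X Y : C, Module.Finite ℂ (X ⟶ Y))
    (M : Type) [AddCommGroup M] [Module S M] [Module ℂ M] [IsScalarTower ℂ S M]
    [Module.Finite ℂ M] : C ⥤ FGModuleCat.{0} ℂ where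
  obj X := haveI := hfin X Z; FGModuleCat.of ℂ (coind Z e M X)
  map a := haveI := hfin; FGModuleCat.ofHom (coindMap e M a)
  map_id X := by
    apply FGModuleCat.hom_ext
    apply LinearMap.ext
    intro φ
    apply Subtype.ext
    apply LinearMap.ext
    intro u
    exact congrArg φ.1 (Category.id_comp u)
  map_comp {X Y W} a b := by
    apply FGModuleCat.hom_ext
    apply LinearMap.ext
    intro φ
    apply Subtype.ext
    apply LinearMap.ext
    intro u
    exact congrArg φ.1 (Category.assoc a b u)

lemma coindFunctor_lin (hfin : ∀ X Y : C, Module.Finite ℂ (X ⟶ Y))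
    (M : Type) [AddCommGroup M] [Module S M] [Module ℂ M] [IsScalarTower ℂ S M]
    [Module.Finite ℂ M] : PLin C (coindFunctor e hfin M) := by
  refine ⟨⟨?_⟩, ⟨?_⟩⟩
  · intro X Y a b
    apply FGModuleCat.hom_ext
    apply LinearMap.ext
    intro φ
    apply Subtype.ext
    apply LinearMap.ext
    intro u
    refine (congrArg φ.1 (Preadditive.add_comp _ _ _ a b u)).trans ?_
    exact φ.1.map_add _ _
  · intro X Y a c
    apply FGModuleCat.hom_ext
    apply LinearMap.ext
    intro φ
    apply Subtype.ext
    apply LinearMap.ext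
    intro u
    refine (congrArg φ.1 (Linear.smul_comp _ _ _ c a u)).trans ?_
    exact φ.1.map_smul _ _

def coindEval (hfin : ∀ X Y : C, Module.Finite ℂ (X ⟶ Y))
    (M : Type) [AddCommGroup M] [Module S M] [Module ℂ M] [IsScalarTower ℂ S M]
    [Module.Finite ℂ M] :
    Ev e (⟨coindFunctor e hfin M, coindFunctor_lin e hfin M⟩ : (PLin C).FullSubcategory)
      →ₗ[S] M where
  toFun φ := (show coind Z e M Z from φ).1 (𝟙 Z)
  map_add' φ ψ := rfl
  map_smul' s φ := by
    have h := (show coind Z e M Z from φ).2 s (𝟙 Z)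
    rw [Category.id_comp] at h
    refine Eq.trans ?_ h
    exact congrArg (show coind Z e M Z from φ).1 (Category.comp_id (e s : Z ⟶ Z))

lemma coindEval_bij (hfin : ∀ X Y : C, Module.Finite ℂ (X ⟶ Y))
    (M : Type) [AddCommGroup M] [Module S M] [Module ℂ M] [IsScalarTower ℂ S M]
    [Module.Finite ℂ M] : Function.Bijective (coindEval e hfin M) := by
  constructor
  · intro φ ψ h
    have h : (show coind Z e M Z from φ).1 (𝟙 Z) = (show coind Z e M Z from ψ).1 (𝟙 Z) := h
    show (show coind Z e M Z from φ) = (show coind Z e M Z from ψ)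
    generalize (show coind Z e M Z from φ) = φ at *
    generalize (show coind Z e M Z from ψ) = ψ at *
    apply Subtype.ext
    apply LinearMap.ext
    intro u
    have h1 := φ.2 (e.symm u) (𝟙 Z)
    have h2 := ψ.2 (e.symm u) (𝟙 Z)
    rw [AlgEquiv.apply_symm_apply, Category.id_comp] at h1 h2
    rw [h1, h2, h]
  · intro m
    let φ : coind Z e M Z := ⟨
      { toFun := fun u => e.symm u • m
        map_add' := fun u v => by
          rw [← add_smul]; exact congrArg (· • m) (map_add e.symm (u : End Z) v)
        map_smul' := fun c u => by
          rw [RingHom.id_apply, ← smul_assoc]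
          exact congrArg (· • m) (map_smul e.symm c (u : End Z)) }, by
      intro s u
      show e.symm (u ≫ (e s : Z ⟶ Z)) • m = s • e.symm u • m
      rw [← mul_smul]
      congr 1
      apply e.injective
      rw [map_mul, AlgEquiv.apply_symm_apply, AlgEquiv.apply_symm_apply]
      rfl⟩
    refine ⟨φ, ?_⟩
    show e.symm (1 : End Z) • m = m
    rw [map_one, one_smul]

lemma ev_essSurj (hfin : ∀ X Y : C, Module.Finite ℂ (X ⟶ Y)) : (evFunctor e).EssSurj where
  mem_essImage M := by
    letI : Module ℂ M := Module.compHom M (algebraMap ℂ S)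
    haveI : IsScalarTower ℂ S M := ⟨fun c s m => by
      rw [Algebra.smul_def, mul_smul]; rfl⟩
    haveI : Module.Finite ℂ S := haveI := hfin Z Z
      Module.Finite.equiv (M := (Z ⟶ Z)) e.symm.toLinearEquiv
    haveI : Module.Finite ℂ M := Module.Finite.trans S M
    refine ⟨⟨coindFunctor e hfin M, coindFunctor_lin e hfin M⟩, ⟨?_⟩⟩
    exact (LinearEquiv.ofBijective (coindEval e hfin M) (coindEval_bij e hfin M)).toFGModuleCatIso

lemma morita (e : S ≃ₐ[ℂ] End Z) (hZ : Gen Z) (hfin : ∀ X Y : C, Module.Finite ℂ (X ⟶ Y)) :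
    Nonempty ((PLin C).FullSubcategory ≌ FGModuleCat.{0} S) := by
  haveI := ev_faithful e hZ
  haveI := ev_full e hZ
  haveI := ev_essSurj e hfin
  haveI : (evFunctor e).IsEquivalence := {}
  exact ⟨(evFunctor e).asEquivalence⟩

end Morita

/-! ### The main theorem -/

/-- the Schur algebra is the endomorphism ring of `V_n` -/
def schurEquiv (Q q : ℂ) (d n : ℕ) (hn : 0 < n) :
    ↥(schurB Q q n d) ≃ₐ[ℂ] End (⟨n, hn⟩ : CBObj ℂ Q q d) where
  toFun f := ⟨f.1, fun i hi =>
    ((Subalgebra.mem_centralizer_iff ℂ).1 f.2 _ ⟨i, hi, rfl⟩).symm⟩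
  invFun f := ⟨f.1, (Subalgebra.mem_centralizer_iff ℂ).2 (by
    rintro _ ⟨i, hi, rfl⟩
    exact (f.2 i hi).symm)⟩
  left_inv f := rfl
  right_inv f := rfl
  map_mul' f g := rfl
  map_add' f g := rfl
  commutes' c := by
    apply Subtype.ext
    rfl

lemma gen_of_thru (Q q : ℂ) (hQ : Q ≠ 0) (hq : q ≠ 0)
    (hgen : ∀ a b : ℤ, (a, b) ≠ (0, 0) → Q ^ a * q ^ b ≠ 1)
    (d n : ℕ) (hn0 : 0 < n) (hn : 2 * d ≤ n) : Gen (⟨n, hn0⟩ : CBObj ℂ Q q d) := by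
  intro X
  have h := thru_all Q q hQ hq hgen d X.m n hn
  obtain ⟨N, c, a, hca⟩ := Submodule.mem_span_set'.1 h
  choose f hf g hg hfg using fun i => (a i).2
  refine ⟨N, fun i => (⟨f i, hf i⟩ : interSub Q q d X.m n),
    fun i => (c i • ⟨g i, hg i⟩ : interSub Q q d n X.m), ?_⟩
  apply Subtype.ext
  show _ = LinearMap.id
  rw [← hca]
  refine (map_sum (interSub Q q d X.m X.m).subtype _ _).trans ?_
  refine Finset.sum_congr rfl fun i _ => ?_
  rw [hfg i]
  rfl

/-- Over `ℂ` with generic `Q, q` and `n ≥ 2d`, the category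
`𝒫^d_{Q,q}` of `ℂ`-linear functors from `𝒞^B_d` to finite-dimensional `ℂ`-vector
spaces is equivalent to the category of finite-dimensional modules over the
Schur algebra `S^B_{Q,q}(n; d)`. -/
theorem polynomial_functors_representability_generic
    (Q q : ℂ) (hQ : Q ≠ 0) (hq : q ≠ 0)
    (hgen : ∀ a b : ℤ, (a, b) ≠ (0, 0) → Q ^ a * q ^ b ≠ 1)
    (d n : ℕ) (hd : 1 ≤ d) (hn : 2 * d ≤ n) :
    Nonempty (PolFun ℂ Q q d ≌ FGModuleCat.{0} ↥(schurB Q q n d)) := by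
  have hn0 : 0 < n := by omega
  have hfin : ∀ X Y : CBObj ℂ Q q d, Module.Finite ℂ (X ⟶ Y) := fun X Y =>
    inferInstanceAs (Module.Finite ℂ (interSub Q q d X.m Y.m))
  exact morita (schurEquiv Q q d n hn0) (gen_of_thru Q q hQ hq hgen d n hn0 hn) hfin

end QSP
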